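/- Let φ be a fractional routing of a finite family H of demands on the bidirected ring on n ≥ 2 nodes. Then there exists a fractional routing φ' of H such that: (i) the load of φ' on every edge of the ring is at most the load of φ on that edge; (ii) φ'(f) = φ(f) for every demand f that is not split under φ; and (iii) no two distinct demands that are split under φ' form a parallel pair. -/

import Mathlib

open Finset

/-- A demand on the bidirected ring on `n` nodes: a pair of distinct nodes together
with a positive demand value. -/
structure Demand (n : ℕ) where
  s : ZMod n
  t : ZMod n
  hst : s ≠ t
  d : ℝ
  hd : 0 < d

/-- The forward edge `F i` (from `i` to `i+1`) lies on the forward path from `s` to `t`. -/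
def OnFwdPath (n : ℕ) (s t i : ZMod n) : Prop :=
  (i - s).val < (t - s).val

/-- The backward edge `B i` (from `i+1` to `i`) lies on the backward path from `s` to `t`. -/
def OnBwdPath (n : ℕ) (s t i : ZMod n) : Prop :=
  (t - s).val ≤ (i - s).val

instance (n : ℕ) (s t i : ZMod n) : Decidable (OnFwdPath n s t i) :=
  inferInstanceAs (Decidable (_ < _))

instance (n : ℕ) (s t i : ZMod n) : Decidable (OnBwdPath n s t i) :=
  inferInstanceAs (Decidable (_ ≤ _))

/-- An edge of the bidirected ring: `(true, i)` is the forward edge `F i`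
(from `i` to `i+1`), and `(false, i)` is the backward edge `B i` (from `i+1` to `i`). -/
abbrev RingEdge (n : ℕ) := Bool × ZMod n

/-- The load of a routing `φ` of the family of demands `f` on an edge of the ring. -/
def edgeLoad {n : ℕ} {ι : Type*} [Fintype ι] (f : ι → Demand n) (φ : ι → ℝ) :
    RingEdge n → ℝ
  | (true, i) => ∑ a, if OnFwdPath n (f a).s (f a).t i then φ a * (f a).d else 0
  | (false, i) => ∑ a, if OnBwdPath n (f a).s (f a).t i then (1 - φ a) * (f a).d else 0

/-- `φ` is a fractional routing: all its values lie in `[0,1]`. -/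
def IsFracRouting {ι : Type*} (φ : ι → ℝ) : Prop := ∀ a, 0 ≤ φ a ∧ φ a ≤ 1

/-- `φ` is an integral routing: each demand is routed entirely forward or entirely backward. -/
def IsIntRouting {ι : Type*} (φ : ι → ℝ) : Prop := ∀ a, φ a = 0 ∨ φ a = 1

/-- The demand indexed by `a` is split under `φ`. -/
def IsSplit {ι : Type*} (φ : ι → ℝ) (a : ι) : Prop := 0 < φ a ∧ φ a < 1

/-- Demands `f1 = (s1,t1)` and `f2 = (s2,t2)` are parallel (in this order): there are
integers `1 ≤ a ≤ b < g ≤ n` with `t1 = s1 + a`, `t2 = s1 + b`, `s2 = s1 + g`. -/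
def Parallel (n : ℕ) (f1 f2 : Demand n) : Prop :=
  ∃ a b g : ℕ, 1 ≤ a ∧ a ≤ b ∧ b < g ∧ g ≤ n ∧
    f1.t = f1.s + (a : ZMod n) ∧ f2.t = f1.s + (b : ZMod n) ∧ f2.s = f1.s + (g : ZMod n)

/-- If `f1` and `f2` are parallel, the forward path of `f1` is contained in that of `f2`. -/
theorem Parallel.onFwdPath {n : ℕ} (hn : 2 ≤ n) {f1 f2 : Demand n} (h : Parallel n f1 f2)
    {i : ZMod n} (hi : OnFwdPath n f1.s f1.t i) : OnFwdPath n f2.s f2.t i := by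
  obtain ⟨a, b, g, h1, hab, hbg, hgn, ht1, ht2, hs2⟩ := h
  have : NeZero n := ⟨by omega⟩
  have hi' : i = f1.s + (((i - f1.s).val : ℕ) : ZMod n) := by simp
  unfold OnFwdPath at *
  have hta : (f1.t - f1.s).val = a := by
    rw [ht1, add_sub_cancel_left, ZMod.val_natCast_of_lt (by omega)]
  generalize (i - f1.s).val = j at hi hi'
  have val_sub (k : ℕ) (hk : k < g) : (f1.s + (k : ZMod n) - f2.s).val = k + (n - g) := by
    have : f1.s + (k : ZMod n) - f2.s = ((k + (n - g) : ℕ) : ZMod n) := by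
      rw [hs2]
      push_cast [hgn]
      simp
      ring
    rw [this, ZMod.val_natCast_of_lt (by omega)]
  rw [ht2, hi', val_sub j (by omega), val_sub b hbg]
  omega

theorem onBwdPath_iff_not_onFwdPath {n : ℕ} {s t i : ZMod n} :
    OnBwdPath n s t i ↔ ¬ OnFwdPath n s t i := not_lt.symm

open Classical in
/-- The routing obtained from `φ` by moving an amount `ε` of demand `a1` to its forward path and
the same amount of demand `a2` to its backward path. -/
noncomputable def shiftRouting {n : ℕ} {ι : Type*} (f : ι → Demand n) (φ : ι → ℝ) (a1 a2 : ι)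
    (ε : ℝ) : ι → ℝ := fun c =>
  φ c + (if c = a1 then ε / (f c).d else 0) - (if c = a2 then ε / (f c).d else 0)

theorem edgeLoad_shiftRouting_le {n : ℕ} (hn : 2 ≤ n) {ι : Type*} [Fintype ι] (f : ι → Demand n)
    (φ : ι → ℝ) {a1 a2 : ι} (h : Parallel n (f a1) (f a2)) {ε : ℝ} (hε : 0 ≤ ε) (e : RingEdge n) :
    edgeLoad f (shiftRouting f φ a1 a2 ε) e ≤ edgeLoad f φ e := by
  classical
  obtain ⟨_ | _, i⟩ := e
  · have key : edgeLoad f (shiftRouting f φ a1 a2 ε) (false, i) = edgeLoad f φ (false, i)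
        - (if OnBwdPath n (f a1).s (f a1).t i then ε else 0)
        + (if OnBwdPath n (f a2).s (f a2).t i then ε else 0) := by
      rw [← Fintype.sum_ite_eq' a1 (fun c => if OnBwdPath n (f c).s (f c).t i then ε else 0),
        ← Fintype.sum_ite_eq' a2 (fun c => if OnBwdPath n (f c).s (f c).t i then ε else 0)]
      simp only [edgeLoad]
      rw [← sum_sub_distrib, ← sum_add_distrib]
      refine sum_congr rfl fun c _ => ?_
      have := (f c).hd.ne'
      unfold shiftRouting
      split_ifs <;> field_simp <;> ring
    rw [key]
    have := h.onFwdPath hn (i := i)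
    simp only [onBwdPath_iff_not_onFwdPath]
    split_ifs <;> first | linarith | tauto
  · have key : edgeLoad f (shiftRouting f φ a1 a2 ε) (true, i) = edgeLoad f φ (true, i)
        + (if OnFwdPath n (f a1).s (f a1).t i then ε else 0)
        - (if OnFwdPath n (f a2).s (f a2).t i then ε else 0) := by
      rw [← Fintype.sum_ite_eq' a1 (fun c => if OnFwdPath n (f c).s (f c).t i then ε else 0),
        ← Fintype.sum_ite_eq' a2 (fun c => if OnFwdPath n (f c).s (f c).t i then ε else 0)]
      simp only [edgeLoad]
      rw [← sum_add_distrib, ← sum_sub_distrib]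
      refine sum_congr rfl fun c _ => ?_
      have := (f c).hd.ne'
      unfold shiftRouting
      split_ifs <;> field_simp <;> ring
    rw [key]
    have := h.onFwdPath hn (i := i)
    split_ifs <;> first | linarith | tauto

/-- Two split parallel demands can be rerouted so that one of them is no longer split. -/
theorem exists_unsplit_of_parallel {n : ℕ} (hn : 2 ≤ n) {ι : Type*} [Fintype ι]
    (f : ι → Demand n) (φ : ι → ℝ) (hφ : IsFracRouting φ) {a1 a2 : ι} (hne : a1 ≠ a2)
    (h1 : IsSplit φ a1) (h2 : IsSplit φ a2) (h : Parallel n (f a1) (f a2)) :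
    ∃ ψ : ι → ℝ, IsFracRouting ψ ∧ (∀ e, edgeLoad f ψ e ≤ edgeLoad f φ e) ∧
      (∀ a, ¬ IsSplit φ a → ψ a = φ a) ∧ ∃ a, IsSplit φ a ∧ ¬ IsSplit ψ a := by
  have hd1 := (f a1).hd
  have hd2 := (f a2).hd
  have hx : 0 < (1 - φ a1) * (f a1).d := mul_pos (by linarith [h1.2]) hd1
  have hy : 0 < φ a2 * (f a2).d := mul_pos h2.1 hd2
  set ε := min ((1 - φ a1) * (f a1).d) (φ a2 * (f a2).d) with hεdef
  have hε : 0 < ε := lt_min hx hy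
  have e1 : shiftRouting f φ a1 a2 ε a1 = φ a1 + ε / (f a1).d := by
    simp [shiftRouting, hne]
  have e2 : shiftRouting f φ a1 a2 ε a2 = φ a2 - ε / (f a2).d := by
    simp [shiftRouting, hne.symm]
  have e3 (c : ι) (hc1 : c ≠ a1) (hc2 : c ≠ a2) : shiftRouting f φ a1 a2 ε c = φ c := by
    simp [shiftRouting, hc1, hc2]
  have l1 : ε / (f a1).d ≤ 1 - φ a1 := (div_le_iff₀ hd1).2 (min_le_left _ _)
  have l2 : ε / (f a2).d ≤ φ a2 := (div_le_iff₀ hd2).2 (min_le_right _ _)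
  have p1 : 0 < ε / (f a1).d := div_pos hε hd1
  have p2 : 0 < ε / (f a2).d := div_pos hε hd2
  refine ⟨shiftRouting f φ a1 a2 ε, fun c => ?_, edgeLoad_shiftRouting_le hn f φ h hε.le,
    fun c hc => e3 c ?_ ?_, ?_⟩
  · by_cases hc1 : c = a1
    · subst hc1
      rw [e1]
      exact ⟨by linarith [h1.1], by linarith⟩
    by_cases hc2 : c = a2
    · subst hc2
      rw [e2]
      exact ⟨by linarith, by linarith [h2.2]⟩
    rw [e3 c hc1 hc2]
    exact hφ c
  · rintro rfl
    exact hc h1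
  · rintro rfl
    exact hc h2
  · rcases min_choice ((1 - φ a1) * (f a1).d) (φ a2 * (f a2).d) with hm | hm
    · refine ⟨a1, h1, fun hs => hs.2.ne ?_⟩
      rw [e1, hεdef, hm, mul_div_cancel_right₀ _ hd1.ne']
      ring
    · refine ⟨a2, h2, fun hs => hs.1.ne' ?_⟩
      rw [e2, hεdef, hm, mul_div_cancel_right₀ _ hd2.ne', sub_self]

/-- Every fractional routing can be replaced by a fractional routing with
pointwise no larger loads, agreeing with the original on all non-split demands, in which
no two distinct split demands form a parallel pair. -/
theorem stmt2 (n : ℕ) (hn : 2 ≤ n) {ι : Type*} [Fintype ι]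
    (f : ι → Demand n) (φ : ι → ℝ) (hφ : IsFracRouting φ) :
    ∃ φ' : ι → ℝ, IsFracRouting φ' ∧
      (∀ e, edgeLoad f φ' e ≤ edgeLoad f φ e) ∧
      (∀ a, ¬ IsSplit φ a → φ' a = φ a) ∧
      (∀ a1 a2, a1 ≠ a2 → IsSplit φ' a1 → IsSplit φ' a2 →
        ¬ (Parallel n (f a1) (f a2) ∨ Parallel n (f a2) (f a1))) := by
  classical
  induction hk : #{a | IsSplit φ a} using Nat.strong_induction_on generalizing φ with
  | _ k ih =>
  by_cases hpar : ∃ a1 a2, a1 ≠ a2 ∧ IsSplit φ a1 ∧ IsSplit φ a2 ∧ Parallel n (f a1) (f a2)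
  · obtain ⟨a1, a2, hne, h1, h2, h⟩ := hpar
    obtain ⟨ψ, hψ, hload, hsame, a, ha, ha'⟩ :=
      exists_unsplit_of_parallel hn f φ hφ hne h1 h2 h
    have hsplit (c : ι) (hc : ¬ IsSplit φ c) : ¬ IsSplit ψ c := by
      simpa only [IsSplit, hsame c hc] using hc
    have hlt : #{a | IsSplit ψ a} < k := by
      rw [← hk]
      refine card_lt_card ((ssubset_iff_of_subset fun c hc => ?_).2 ⟨a, ?_, ?_⟩)
      · rw [mem_filter_univ] at hc ⊢
        exact by_contra fun hc' => hsplit c hc' hc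
      · simpa using ha
      · simpa using ha'
    obtain ⟨φ', hφ', hload', hsame', hnp⟩ := ih _ hlt ψ hψ rfl
    exact ⟨φ', hφ', fun e => (hload' e).trans (hload e),
      fun c hc => (hsame' c (hsplit c hc)).trans (hsame c hc), hnp⟩
  · refine ⟨φ, hφ, fun _ => le_rfl, fun _ _ => rfl, fun a1 a2 hne h1 h2 h => hpar ?_⟩
    rcases h with h | h
    · exact ⟨a1, a2, hne, h1, h2, h⟩
    · exact ⟨a2, a1, hne.symm, h2, h1, h⟩
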